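/- For the commutative ring A = ℤ[t]/(t³), the first homology H₁ = ker ∂₁ / im ∂₂ of the partial complex, equipped with its A-module structure [a]·[x⊗y⊗z] = [ax⊗y⊗z − x⊗ya⊗z + x⊗y⊗az], is a cyclic A-module: it is generated by a single element u satisfying 2u = 0 and t²·u = 0, and is isomorphic as an A-module to A/(2, t²). -/

import Mathlib

open TensorProduct

set_option synthInstance.maxHeartbeats 1000000
set_option maxHeartbeats 1000000

/-- The commutative ring `A = ℤ[t]/(t³)`. -/
noncomputable abbrev A : Type :=
  Polynomial ℤ ⧸ Ideal.span ({Polynomial.X ^ 3} : Set (Polynomial ℤ))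

/-- The class `t` of the variable in `A = ℤ[t]/(t³)`. -/
noncomputable abbrev tA : A :=
  Ideal.Quotient.mk (Ideal.span ({Polynomial.X ^ 3} : Set (Polynomial ℤ))) Polynomial.X

/-- A function on triples of exponents satisfying the relations imposed by `∂₂` in
`ℤ[t]/(t³)` takes values in the subgroup generated by two elements of order dividing `2`. -/
lemma symmetric_relations_mem_span {M : Type*} [AddCommGroup M] (f : ℕ → ℕ → ℕ → M)
    (hl : ∀ i j k, f (i + 3) j k = 0) (hm : ∀ i j k, f i (j + 3) k = 0)
    (hone : ∀ i, f 0 i 0 = 0)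
    (hrel : ∀ i j k l, f (i + j) k l + f l (k + i) j + f (j + k + i) 0 l + f l (j + k) i = 0) :
    (2 : ℤ) • f 1 0 1 = 0 ∧ (2 : ℤ) • f 1 1 1 = 0 ∧
      ∀ i < 3, ∀ j < 3, ∀ k < 3, f i j k ∈ Submodule.span ℤ {f 1 0 1, f 1 1 1} := by
  have hleft (i) : f i 0 0 = 0 := by
    have h₁ := hrel 0 0 i 0
    have h₂ := hone i
    simp only [Nat.zero_add, Nat.add_zero] at h₁
    grind
  have hflip (i j) : f 0 j i = - f i j 0 := by
    have h₁ := hrel i 0 j 0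
    simp only [Nat.zero_add, Nat.add_zero] at h₁
    have h₂ := hone (j + i)
    have h₃ := hleft (j + i)
    grind
  have hend (i j) : f j i 0 = - f i 0 j := by
    have h₁ := hrel 0 i 0 j
    have h₂ := hrel i 0 0 j
    have h₃ := hrel 0 0 i j
    have h₄ := hrel j 0 i 0
    have h₅ := hflip j i
    have h₆ := hone (i + j)
    have h₇ := hleft (i + j)
    simp only [Nat.zero_add, Nat.add_zero] at *
    grind
  have hanti (i j k) : f i j k = - f k j i := by
    have h₁ := hrel i 0 j k
    have h₂ := hend (j + i) k
    simp only [Nat.zero_add, Nat.add_zero] at h₁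
    grind
  have hmain (i j k l) : f (i + j) k l = f j (k + i) l + f i (j + k) l - f (j + k + i) 0 l := by
    have h₁ := hrel i j k l
    have h₂ := hanti l (k + i) j
    have h₃ := hanti l (j + k) i
    grind
  have h21 (l) : f 2 1 l = (2 : ℤ) • f 1 2 l := by
    have h₁ := hmain 1 1 1 l
    have h₂ := hl 0 0 l
    simp only [Nat.reduceAdd] at *
    grind
  have h12 (l) : (3 : ℤ) • f 1 2 l = 0 := by
    have h₁ := hmain 2 1 0 l
    have h₂ := hl 0 0 l
    have h₃ := h21 l
    simp only [Nat.reduceAdd] at *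
    grind
  have htors {x : M} (h₂ : (2 : ℤ) • x = 0) (h₃ : (3 : ℤ) • x = 0) : x = 0 := by
    rw [← one_smul ℤ x, show (1 : ℤ) = 3 - 2 by norm_num, sub_smul, h₂, h₃, sub_zero]
  have e121 : f 1 2 1 = 0 := htors (by grind [hanti 1 2 1]) (h12 1)
  have e211 : f 2 1 1 = 0 := by grind [h21 1]
  have e112 : f 1 1 2 = 0 := by grind [hanti 1 1 2]
  have e212 : f 2 1 2 = 0 := htors (by grind [hanti 2 1 2]) (by grind [h12 2, h21 2])
  have e122 : f 1 2 2 = 0 := htors (by grind [h21 2]) (h12 2)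
  have e221 : f 2 2 1 = 0 := by grind [hanti 2 2 1]
  have e201 : f 2 0 1 = 0 := by
    have h₁ := hmain 1 1 0 1
    simp only [Nat.reduceAdd] at h₁
    exact htors (by grind [hanti 1 1 1]) (by simpa [hend] using h12 0)
  have e102 : f 1 0 2 = 0 := by grind [hanti 1 0 2]
  have e220 : f 2 2 0 = 0 := by
    have h₁ := hmain 1 1 2 0
    simp only [Nat.reduceAdd] at h₁
    grind [hm 1 0 0, hl 1 0 0]
  have e202 : f 2 0 2 = 0 := by grind [hend 2 2]
  have e222 : f 2 2 2 = 0 := by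
    have h₁ := hmain 1 1 2 2
    simp only [Nat.reduceAdd] at h₁
    grind [hm 1 0 2, hl 1 0 2]
  have hmem₁ : f 1 0 1 ∈ Submodule.span ℤ {f 1 0 1, f 1 1 1} := Submodule.subset_span (by simp)
  have hmem₂ : f 1 1 1 ∈ Submodule.span ℤ {f 1 0 1, f 1 1 1} := Submodule.subset_span (by simp)
  refine ⟨by grind [hanti 1 0 1], by grind [hanti 1 1 1], fun i hi j hj k hk => ?_⟩
  have hzero : (0 : M) ∈ Submodule.span ℤ {f 1 0 1, f 1 1 1} := zero_mem _
  interval_cases i <;> interval_cases j <;> interval_cases k <;> grind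

/-- The reduction `ℤ[t]/(t³) → 𝔽₂[ε]` sending `t` to `ε`. -/
noncomputable def toDual : A →+* DualNumber (ZMod 2) :=
  Ideal.Quotient.lift _ (Polynomial.eval₂RingHom (Int.castRingHom _) DualNumber.eps) (by
    intro a ha
    obtain ⟨b, rfl⟩ := Ideal.mem_span_singleton.mp ha
    simp [pow_succ])

lemma toDual_tA : toDual tA = DualNumber.eps := by
  simp [toDual]

lemma tA_pow_three : tA ^ 3 = 0 := by
  rw [← map_pow]
  exact Ideal.Quotient.eq_zero_iff_mem.mpr (Ideal.mem_span_singleton_self _)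

lemma exists_eq_coeffs (a : A) : ∃ x y z : ℤ, a = (x : A) + (y : A) * tA + (z : A) * tA ^ 2 := by
  obtain ⟨p, rfl⟩ := Ideal.Quotient.mk_surjective a
  induction p using Polynomial.induction_on' with
  | add p q hp hq =>
    obtain ⟨x, y, z, h⟩ := hp
    obtain ⟨x', y', z', h'⟩ := hq
    refine ⟨x + x', y + y', z + z', ?_⟩
    rw [map_add, h, h']
    push_cast
    ring
  | monomial n c =>
    rw [← Polynomial.C_mul_X_pow_eq_monomial, map_mul, map_pow]
    have hc : Ideal.Quotient.mk (Ideal.span {(Polynomial.X : Polynomial ℤ) ^ 3})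
        (Polynomial.C c) = (c : A) := by simp
    rw [hc]
    match n with
    | 0 => exact ⟨c, 0, 0, by simp⟩
    | 1 => exact ⟨0, c, 0, by simp⟩
    | 2 => exact ⟨0, 0, c, by simp⟩
    | n + 3 => exact ⟨0, 0, 0, by rw [pow_add, tA_pow_three]; simp⟩

lemma toDual_coeffs (x y z : ℤ) :
    toDual ((x : A) + (y : A) * tA + (z : A) * tA ^ 2) =
      TrivSqZeroExt.inl (x : ZMod 2) + TrivSqZeroExt.inr (y : ZMod 2) := by
  simp only [map_add, map_mul, map_pow, map_intCast, toDual_tA]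
  ext <;> simp [pow_two]

lemma toDual_surjective : Function.Surjective toDual := by
  intro r
  obtain ⟨x, hx⟩ := ZMod.intCast_surjective r.fst
  obtain ⟨y, hy⟩ := ZMod.intCast_surjective r.snd
  refine ⟨_, (toDual_coeffs x y 0).trans ?_⟩
  rw [hx, hy, TrivSqZeroExt.inl_fst_add_inr_snd_eq]

lemma two_dvd_of_toDual_coeffs_eq_zero {x y z : ℤ}
    (h : toDual ((x : A) + (y : A) * tA + (z : A) * tA ^ 2) = 0) : 2 ∣ x ∧ 2 ∣ y := by
  rw [toDual_coeffs] at h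
  have hx := congrArg TrivSqZeroExt.fst h
  have hy := congrArg TrivSqZeroExt.snd h
  simp only [TrivSqZeroExt.fst_add, TrivSqZeroExt.snd_add, TrivSqZeroExt.fst_inl,
    TrivSqZeroExt.snd_inl, TrivSqZeroExt.fst_inr, TrivSqZeroExt.snd_inr, add_zero, zero_add,
    TrivSqZeroExt.fst_zero, TrivSqZeroExt.snd_zero, ZMod.intCast_eq_zero_iff_even,
    even_iff_two_dvd] at hx hy
  exact ⟨hx, hy⟩

lemma ker_toDual : RingHom.ker toDual = Ideal.span ({2, tA ^ 2} : Set A) := by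
  apply le_antisymm
  · intro a ha
    obtain ⟨x, y, z, rfl⟩ := exists_eq_coeffs a
    obtain ⟨⟨m, rfl⟩, ⟨n, rfl⟩⟩ := two_dvd_of_toDual_coeffs_eq_zero ha
    refine Ideal.mem_span_pair.mpr ⟨m + n * tA, z, ?_⟩
    push_cast
    ring
  · rw [Ideal.span_le]
    rintro a (rfl | rfl)
    · simp only [SetLike.mem_coe, RingHom.mem_ker, map_ofNat]
      exact TrivSqZeroExt.ext (by decide) (by decide)
    · simp [toDual_tA, pow_two]

/-- The `ε`-coefficient of the reduction to `𝔽₂[ε]`, regarded as a scalar in `𝔽₂[ε]`. -/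
noncomputable def epsCoeff : A →ₗ[ℤ] DualNumber (ZMod 2) :=
  ((TrivSqZeroExt.inlHom (ZMod 2) (ZMod 2)).toAddMonoidHom.comp
    ((TrivSqZeroExt.sndHom (ZMod 2) (ZMod 2)).toAddMonoidHom.comp
      toDual.toAddMonoidHom)).toIntLinearMap

lemma epsCoeff_apply (a : A) : epsCoeff a = TrivSqZeroExt.inl (toDual a).snd := rfl

/-- The map `x ⊗ y ⊗ z ↦ x₁y₁z + x₁yz₁ + xy₁z₁` to `𝔽₂[ε]` inducing the isomorphism on `H₁`. -/
noncomputable def detect : A ⊗[ℤ] (A ⊗[ℤ] A) →ₗ[ℤ] DualNumber (ZMod 2) :=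
  let π : A →ₗ[ℤ] DualNumber (ZMod 2) := toDual.toAddMonoidHom.toIntLinearMap
  let μ := LinearMap.mul' ℤ (DualNumber (ZMod 2))
  let m (a b c : A →ₗ[ℤ] DualNumber (ZMod 2)) :=
    μ ∘ₗ TensorProduct.map a (μ ∘ₗ TensorProduct.map b c)
  m epsCoeff epsCoeff π + m epsCoeff π epsCoeff + m π epsCoeff epsCoeff

/-- The value of `detect` on a simple tensor, in terms of the images in `𝔽₂[ε]`. -/
def detectDual (x y z : DualNumber (ZMod 2)) : DualNumber (ZMod 2) :=
  .inl x.snd * (.inl y.snd * z) + .inl x.snd * (y * .inl z.snd) +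
    x * (.inl y.snd * .inl z.snd)

lemma detect_tmul (x y z : A) :
    detect (x ⊗ₜ (y ⊗ₜ z)) = detectDual (toDual x) (toDual y) (toDual z) := rfl

lemma detectDual_relation (a b c d : DualNumber (ZMod 2)) :
    detectDual (a * b) c d + detectDual d (c * a) b + detectDual (b * c * a) 1 d +
      detectDual d (b * c) a = 0 := by
  obtain ⟨a₀, a₁⟩ := a
  obtain ⟨b₀, b₁⟩ := b
  obtain ⟨c₀, c₁⟩ := c
  obtain ⟨d₀, d₁⟩ := d
  apply TrivSqZeroExt.ext <;> revert a₀ a₁ b₀ b₁ c₀ c₁ d₀ d₁ <;> decide +kernel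

lemma detectDual_smul (a x y z : DualNumber (ZMod 2)) :
    detectDual (a * x) y z - detectDual x (y * a) z + detectDual x y (a * z) =
      a * detectDual x y z := by
  obtain ⟨a₀, a₁⟩ := a
  obtain ⟨x₀, x₁⟩ := x
  obtain ⟨y₀, y₁⟩ := y
  obtain ⟨z₀, z₁⟩ := z
  apply TrivSqZeroExt.ext <;> revert a₀ a₁ x₀ x₁ y₀ y₁ z₀ z₁ <;> decide +kernel

lemma detect_one : detect (tA ⊗ₜ (1 ⊗ₜ tA)) = 1 := by
  rw [detect_tmul, toDual_tA, map_one]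
  exact TrivSqZeroExt.ext (by decide) (by decide)

lemma detect_eps : detect (tA ⊗ₜ (tA ⊗ₜ tA)) = DualNumber.eps := by
  rw [detect_tmul, toDual_tA]
  exact TrivSqZeroExt.ext (by decide) (by decide)

lemma detect_smul (a x y z : A) :
    detect ((a * x) ⊗ₜ (y ⊗ₜ z) - x ⊗ₜ ((y * a) ⊗ₜ z) + x ⊗ₜ (y ⊗ₜ (a * z))) =
      toDual a * detect (x ⊗ₜ (y ⊗ₜ z)) := by
  simp only [map_add, map_sub, detect_tmul, map_mul, detectDual_smul]

lemma detect_surjective : Function.Surjective detect := by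
  intro r
  obtain ⟨a, rfl⟩ := toDual_surjective r
  exact ⟨_, (detect_smul a tA 1 tA).trans (by rw [detect_one, mul_one])⟩

lemma submodule_eq_top_of_pow_tA_mem {p : Submodule ℤ A} (h : ∀ i < 3, tA ^ i ∈ p) : p = ⊤ := by
  refine eq_top_iff.mpr fun a _ => ?_
  obtain ⟨x, y, z, rfl⟩ := exists_eq_coeffs a
  have h₀ := p.smul_mem x (h 0 (by norm_num))
  have h₁ := p.smul_mem y (h 1 (by norm_num))
  have h₂ := p.smul_mem z (h 2 (by norm_num))
  simp only [zsmul_eq_mul, pow_zero, pow_one, mul_one] at h₀ h₁ h₂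
  exact add_mem (add_mem h₀ h₁) h₂

lemma submodule_eq_top_of_tmul_pow_tA_mem {p : Submodule ℤ (A ⊗[ℤ] (A ⊗[ℤ] A))}
    (h : ∀ i < 3, ∀ j < 3, ∀ k < 3, (tA ^ i) ⊗ₜ ((tA ^ j) ⊗ₜ (tA ^ k)) ∈ p) : p = ⊤ := by
  have h₁ (a : A) : ∀ j < 3, ∀ k < 3, a ⊗ₜ ((tA ^ j) ⊗ₜ (tA ^ k)) ∈ p := by
    intro j hj k hk
    have := submodule_eq_top_of_pow_tA_mem
      (p := p.comap ((TensorProduct.mk ℤ A (A ⊗[ℤ] A)).flip ((tA ^ j) ⊗ₜ (tA ^ k))))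
      fun i hi => h i hi j hj k hk
    exact this.ge (Submodule.mem_top (x := a))
  have h₂ (a b : A) : ∀ k < 3, a ⊗ₜ (b ⊗ₜ (tA ^ k)) ∈ p := by
    intro k hk
    have := submodule_eq_top_of_pow_tA_mem
      (p := p.comap (TensorProduct.mk ℤ A (A ⊗[ℤ] A) a ∘ₗ
        (TensorProduct.mk ℤ A A).flip (tA ^ k)))
      fun j hj => h₁ a j hj k hk
    exact this.ge (Submodule.mem_top (x := b))
  have h₃ (a b c : A) : a ⊗ₜ (b ⊗ₜ c) ∈ p := by
    have := submodule_eq_top_of_pow_tA_mem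
      (p := p.comap (TensorProduct.mk ℤ A (A ⊗[ℤ] A) a ∘ₗ TensorProduct.mk ℤ A A b))
      fun k hk => h₂ a b k hk
    exact this.ge (Submodule.mem_top (x := c))
  refine Submodule.eq_top_iff'.mpr fun v => ?_
  induction v using TensorProduct.induction_on with
  | zero => exact zero_mem p
  | add v w hv hw => exact add_mem hv hw
  | tmul a w =>
    induction w using TensorProduct.induction_on with
    | zero => rw [TensorProduct.tmul_zero]; exact zero_mem p
    | add v w hv hw => rw [TensorProduct.tmul_add]; exact add_mem hv hw
    | tmul b c => exact h₃ a b c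

lemma range_le_ker_detect
    (d₂ : ((A ⊗[ℤ] (A ⊗[ℤ] (A ⊗[ℤ] A))) × A) →ₗ[ℤ] A ⊗[ℤ] (A ⊗[ℤ] A))
    (h₂ : ∀ a b c d : A, d₂ (a ⊗ₜ[ℤ] (b ⊗ₜ[ℤ] (c ⊗ₜ[ℤ] d)), 0) =
      (a * b) ⊗ₜ[ℤ] (c ⊗ₜ[ℤ] d) + d ⊗ₜ[ℤ] ((c * a) ⊗ₜ[ℤ] b) +
        (b * c * a) ⊗ₜ[ℤ] ((1 : A) ⊗ₜ[ℤ] d) + d ⊗ₜ[ℤ] ((b * c) ⊗ₜ[ℤ] a))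
    (h₃ : ∀ a : A, d₂ (0, a) = (1 : A) ⊗ₜ[ℤ] (a ⊗ₜ[ℤ] (1 : A))) :
    LinearMap.range d₂ ≤ LinearMap.ker detect := by
  have hinl : detect ∘ₗ d₂ ∘ₗ LinearMap.inl ℤ _ _ = 0 := by
    refine TensorProduct.ext (LinearMap.ext fun a => TensorProduct.ext (LinearMap.ext fun b =>
      TensorProduct.ext (LinearMap.ext fun c => LinearMap.ext fun d => ?_)))
    change detect (d₂ (a ⊗ₜ[ℤ] (b ⊗ₜ[ℤ] (c ⊗ₜ[ℤ] d)), 0)) = 0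
    simp only [h₂, map_add, detect_tmul, map_mul, map_one, detectDual_relation]
  rintro _ ⟨⟨p, a⟩, rfl⟩
  rw [LinearMap.mem_ker, ← zero_add a, ← add_zero p, ← Prod.mk_add_mk, map_add, map_add, h₃]
  have hp : detect (d₂ (p, 0)) = 0 := LinearMap.congr_fun hinl p
  rw [hp, detect_tmul, map_one]
  simp [detectDual]

lemma ker_detect
    (d₂ : ((A ⊗[ℤ] (A ⊗[ℤ] (A ⊗[ℤ] A))) × A) →ₗ[ℤ] A ⊗[ℤ] (A ⊗[ℤ] A))
    (h₂ : ∀ a b c d : A, d₂ (a ⊗ₜ[ℤ] (b ⊗ₜ[ℤ] (c ⊗ₜ[ℤ] d)), 0) =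
      (a * b) ⊗ₜ[ℤ] (c ⊗ₜ[ℤ] d) + d ⊗ₜ[ℤ] ((c * a) ⊗ₜ[ℤ] b) +
        (b * c * a) ⊗ₜ[ℤ] ((1 : A) ⊗ₜ[ℤ] d) + d ⊗ₜ[ℤ] ((b * c) ⊗ₜ[ℤ] a))
    (h₃ : ∀ a : A, d₂ (0, a) = (1 : A) ⊗ₜ[ℤ] (a ⊗ₜ[ℤ] (1 : A))) :
    LinearMap.ker detect = LinearMap.range d₂ := by
  have hle := range_le_ker_detect d₂ h₂ h₃
  refine le_antisymm (fun v hv => ?_) hle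
  let q := (LinearMap.range d₂).mkQ
  have hq (p) : q (d₂ p) = 0 :=
    (Submodule.Quotient.mk_eq_zero _).mpr (LinearMap.mem_range_self d₂ p)
  obtain ⟨hu, hw, hspan⟩ := symmetric_relations_mem_span
    (fun i j k => q ((tA ^ i) ⊗ₜ ((tA ^ j) ⊗ₜ (tA ^ k))))
    (fun i j k => by simp [pow_add, tA_pow_three])
    (fun i j k => by simp [pow_add, tA_pow_three])
    (fun i => by simpa [h₃] using hq (0, tA ^ i))
    (fun i j k l => by
      simpa only [h₂, map_add, pow_add, pow_zero] using
        hq ((tA ^ i) ⊗ₜ[ℤ] ((tA ^ j) ⊗ₜ[ℤ] ((tA ^ k) ⊗ₜ[ℤ] (tA ^ l))), 0))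
  simp only [pow_zero, pow_one] at hu hw hspan
  have htop := submodule_eq_top_of_tmul_pow_tA_mem (p := Submodule.comap q (Submodule.span ℤ
    {q (tA ⊗ₜ[ℤ] ((1 : A) ⊗ₜ[ℤ] tA)), q (tA ⊗ₜ[ℤ] (tA ⊗ₜ[ℤ] tA))})) hspan
  obtain ⟨m, n, hmn⟩ := Submodule.mem_span_pair.mp (htop.ge (Submodule.mem_top (x := v)))
  have hmem : m • tA ⊗ₜ[ℤ] ((1 : A) ⊗ₜ[ℤ] tA) + n • tA ⊗ₜ[ℤ] (tA ⊗ₜ[ℤ] tA) - v ∈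
      LinearMap.range d₂ := by
    rw [← Submodule.Quotient.mk_eq_zero]
    change q _ = 0
    rw [map_sub, map_add, map_zsmul, map_zsmul, hmn, sub_self]
  have hdet := hle hmem
  rw [LinearMap.mem_ker, map_sub, LinearMap.mem_ker.mp hv, sub_zero, map_add, map_zsmul,
    map_zsmul, detect_one, detect_eps] at hdet
  have hcoeffs : toDual ((m : A) + (n : A) * tA + ((0 : ℤ) : A) * tA ^ 2) = 0 := by
    simpa [toDual_tA] using hdet
  obtain ⟨⟨m, rfl⟩, ⟨n, rfl⟩⟩ := two_dvd_of_toDual_coeffs_eq_zero hcoeffs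
  rw [← Submodule.Quotient.mk_eq_zero]
  change q v = 0
  rw [← hmn, mul_comm, mul_smul, hu, mul_comm, mul_smul, hw, smul_zero, smul_zero, add_zero]

/-- The isomorphism `A/(2, t²) ≃ 𝔽₂[ε]`. -/
noncomputable def quotientEquivDual :
    (A ⧸ Ideal.span ({2, tA ^ 2} : Set A)) ≃+* DualNumber (ZMod 2) :=
  (Ideal.quotEquivOfEq ker_toDual.symm).trans
    (RingHom.quotientKerEquivOfSurjective toDual_surjective)

lemma quotientEquivDual_smul (a : A) (x : A ⧸ Ideal.span ({2, tA ^ 2} : Set A)) :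
    quotientEquivDual (a • x) = toDual a * quotientEquivDual x := by
  obtain ⟨b, rfl⟩ := Ideal.Quotient.mk_surjective x
  exact map_mul toDual a b

lemma smul_one_quotient (a : A) (J : Ideal A) : a • (1 : A ⧸ J) = Ideal.Quotient.mk J a :=
  congrArg (Ideal.Quotient.mk J) (mul_one a)

/-- For `A = ℤ[t]/(t³)`, the first homology `H₁ = ker ∂₁ / im ∂₂` of the partial
complex, equipped with its `A`-module structure
`[a]·[x⊗y⊗z] = [ax⊗y⊗z − x⊗ya⊗z + x⊗y⊗az]`, is a cyclic `A`-module: it is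
generated by a single element `u` satisfying `2u = 0` and `t²·u = 0`, and is
isomorphic as an `A`-module to `A/(2, t²)`. -/
theorem HS1_int_t_cube_module_structure
    (d₁ : A ⊗[ℤ] (A ⊗[ℤ] A) →ₗ[ℤ] A)
    (d₂ : ((A ⊗[ℤ] (A ⊗[ℤ] (A ⊗[ℤ] A))) × A) →ₗ[ℤ] A ⊗[ℤ] (A ⊗[ℤ] A))
    (h₁ : ∀ a b c : A, d₁ (a ⊗ₜ[ℤ] (b ⊗ₜ[ℤ] c)) = a * b * c - c * b * a)
    (h₂ : ∀ a b c d : A, d₂ (a ⊗ₜ[ℤ] (b ⊗ₜ[ℤ] (c ⊗ₜ[ℤ] d)), 0) =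
      (a * b) ⊗ₜ[ℤ] (c ⊗ₜ[ℤ] d) + d ⊗ₜ[ℤ] ((c * a) ⊗ₜ[ℤ] b) +
        (b * c * a) ⊗ₜ[ℤ] ((1 : A) ⊗ₜ[ℤ] d) + d ⊗ₜ[ℤ] ((b * c) ⊗ₜ[ℤ] a))
    (h₃ : ∀ a : A, d₂ (0, a) = (1 : A) ⊗ₜ[ℤ] (a ⊗ₜ[ℤ] (1 : A))) :
    ∃ sm : Module A (↥(LinearMap.ker d₁) ⧸
        Submodule.comap (LinearMap.ker d₁).subtype (LinearMap.range d₂)),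
      letI := sm
      -- the action is the one induced by `[a]·[x⊗y⊗z] = [ax⊗y⊗z − x⊗ya⊗z + x⊗y⊗az]`
      (∀ (a x y z : A) (h : x ⊗ₜ[ℤ] (y ⊗ₜ[ℤ] z) ∈ LinearMap.ker d₁)
        (h' : (a * x) ⊗ₜ[ℤ] (y ⊗ₜ[ℤ] z) - x ⊗ₜ[ℤ] ((y * a) ⊗ₜ[ℤ] z) +
            x ⊗ₜ[ℤ] (y ⊗ₜ[ℤ] (a * z)) ∈ LinearMap.ker d₁),
        a • (Submodule.Quotient.mk ⟨_, h⟩ :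
            ↥(LinearMap.ker d₁) ⧸
              Submodule.comap (LinearMap.ker d₁).subtype (LinearMap.range d₂)) =
          Submodule.Quotient.mk ⟨_, h'⟩)
      -- it is cyclic, generated by `u` with `2u = 0` and `t²·u = 0`
      ∧ (∃ u : ↥(LinearMap.ker d₁) ⧸
            Submodule.comap (LinearMap.ker d₁).subtype (LinearMap.range d₂),
          (2 : A) • u = 0 ∧ (tA ^ 2) • u = 0 ∧ Submodule.span A {u} = ⊤)
      -- and it is isomorphic as an `A`-module to `A/(2, t²)`
      ∧ Nonempty ((↥(LinearMap.ker d₁) ⧸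
            Submodule.comap (LinearMap.ker d₁).subtype (LinearMap.range d₂)) ≃ₗ[A]
          A ⧸ Ideal.span ({2, tA ^ 2} : Set A)) := by
  have hker : LinearMap.ker d₁ = ⊤ := by
    rw [LinearMap.ker_eq_top]
    refine TensorProduct.ext (LinearMap.ext fun a => TensorProduct.ext (LinearMap.ext fun b =>
      LinearMap.ext fun c => ?_))
    change d₁ (a ⊗ₜ[ℤ] (b ⊗ₜ[ℤ] c)) = 0
    rw [h₁]
    ring
  let φ := detect ∘ₗ (LinearMap.ker d₁).subtype
  have hφ : Submodule.comap (LinearMap.ker d₁).subtype (LinearMap.range d₂) =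
      LinearMap.ker φ := by
    rw [LinearMap.ker_comp, ker_detect d₂ h₂ h₃]
  have hsurj : Function.Surjective φ := fun r => by
    obtain ⟨v, rfl⟩ := detect_surjective r
    exact ⟨⟨v, hker ▸ Submodule.mem_top⟩, rfl⟩
  let e := (Submodule.quotEquivOfEq _ _ hφ).trans (φ.quotKerEquivOfSurjective hsurj)
  let E := e.toAddEquiv.trans quotientEquivDual.symm.toAddEquiv
  have hE (x) : quotientEquivDual (E x) = e x := quotientEquivDual.apply_symm_apply _
  let sm := E.module A
  have hsmul (a : A) (x) : E (a • x) = a • E x := E.apply_symm_apply _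
  let L : _ ≃ₗ[A] A ⧸ Ideal.span ({2, tA ^ 2} : Set A) := { E with map_smul' := hsmul }
  have hzero (a : A) (ha : a ∈ Ideal.span ({2, tA ^ 2} : Set A)) : a • L.symm 1 = 0 := by
    rw [← map_smul, ← map_zero L.symm, smul_one_quotient]
    exact congrArg _ (Ideal.Quotient.eq_zero_iff_mem.mpr ha)
  refine ⟨sm, fun a x y z h h' => ?_, ⟨L.symm 1, hzero _ (Ideal.subset_span (by simp)),
    hzero _ (Ideal.subset_span (by simp)), ?_⟩, ⟨L⟩⟩
  · apply E.injective
    apply quotientEquivDual.injective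
    rw [hsmul, quotientEquivDual_smul, hE, hE]
    exact (detect_smul a x y z).symm
  · refine eq_top_iff.mpr fun x _ => Submodule.mem_span_singleton.mpr ?_
    obtain ⟨a, ha⟩ := Ideal.Quotient.mk_surjective (L x)
    refine ⟨a, ?_⟩
    rw [← map_smul, LinearEquiv.symm_apply_eq, ← ha, smul_one_quotient]
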